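/- Let k, l be natural numbers, n = k + l, let p₀ and p₁ be complex-valued Schwartz functions on ℝ^n × ℝ^n (variables (t,u;τ,μ)) such that for all t ∈ ℝ^k and j = 1,…,l: p₀(t,0,0,0) = 0, ∂p₀/∂u_j(t,0,0,0) = 0 and ∂p₀/∂μ_j(t,0,0,0) = 0. Let a be a complex-valued Schwartz function on ℝ^k × ℝ^l with Fourier transform â(σ,ν) = ∫ e^{−i(t·σ + u·ν)} a(t,u) dt du, and for ħ > 0 set b_ħ(t,v) = (2π)^{−n} ∫_{ℝ^n} e^{i(t·τ + v·μ)} (p₀ + ħ p₁)(t, √ħ v, ħτ, √ħ μ) â(τ,μ) dτ dμ. Then for every (t,v), lim_{ħ→0⁺} ħ^{−1} b_ħ(t,v) = p₁(t,0,0,0) a(t,v) + (1/i) Σ_{j=1}^k ∂p₀/∂τ_j(t,0,0,0) ∂a/∂t_j(t,v) + (1/2) Σ_{i,j=1}^l [ ∂²p₀/∂u_i∂u_j(t,0,0,0) v_i v_j a(t,v) + (2/i) ∂²p₀/∂u_i∂μ_j(t,0,0,0) v_i ∂a/∂v_j(t,v) − ∂²p₀/∂μ_i∂μ_j(t,0,0,0)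 ∂²a/∂v_i∂v_j(t,v) ]. -/

import Mathlib

open MeasureTheory Filter

/-- Tangent direction `∂/∂u_j` in `T^*ℝ^n = (ℝ^k × ℝ^l) × (ℝ^k × ℝ^l)`. -/
def dirU (k l : ℕ) (j : Fin l) :
    ((Fin k → ℝ) × (Fin l → ℝ)) × ((Fin k → ℝ) × (Fin l → ℝ)) :=
  ((0, Pi.single j 1), (0, 0))

/-- Tangent direction `∂/∂μ_j`. -/
def dirMu (k l : ℕ) (j : Fin l) :
    ((Fin k → ℝ) × (Fin l → ℝ)) × ((Fin k → ℝ) × (Fin l → ℝ)) :=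
  ((0, 0), (0, Pi.single j 1))

/-- Tangent direction `∂/∂τ_j`. -/
def dirTau (k l : ℕ) (j : Fin k) :
    ((Fin k → ℝ) × (Fin l → ℝ)) × ((Fin k → ℝ) × (Fin l → ℝ)) :=
  ((0, 0), (Pi.single j 1, 0))


open scoped SchwartzMap FourierTransform LineDeriv

section Taylor

variable {Z F : Type*} [NormedAddCommGroup Z] [NormedSpace ℝ Z] [NormedAddCommGroup F]
  [NormedSpace ℝ F]

theorem hasDerivAt_parabola (z w y : Z) (s : ℝ) :
    HasDerivAt (fun s : ℝ => z + s • w + s ^ 2 • y) (w + (2 * s) • y) s := by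
  have h₁ := (hasDerivAt_id s).smul_const w
  have h₂ := ((hasDerivAt_id s).pow 2).smul_const y
  simpa using (h₁.const_add z).fun_add h₂

theorem hasDerivAt_comp_parabola {f : Z → F} (hf : ContDiff ℝ 2 f) (z w y : Z) (s : ℝ) :
    HasDerivAt (fun s : ℝ => f (z + s • w + s ^ 2 • y))
      (fderiv ℝ f (z + s • w + s ^ 2 • y) (w + (2 * s) • y)) s :=
  ((hf.differentiable (by norm_num)) _).hasFDerivAt.comp_hasDerivAt s
    (hasDerivAt_parabola z w y s)

theorem hasDerivAt_fderiv_comp_parabola {f : Z → F} (hf : ContDiff ℝ 2 f) (z w y : Z) (s : ℝ) :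
    HasDerivAt (fun s : ℝ => fderiv ℝ f (z + s • w + s ^ 2 • y) (w + (2 * s) • y))
      (fderiv ℝ (fderiv ℝ f) (z + s • w + s ^ 2 • y) (w + (2 * s) • y) (w + (2 * s) • y)
        + fderiv ℝ f (z + s • w + s ^ 2 • y) ((2 : ℝ) • y)) s := by
  have hf' : ContDiff ℝ 1 (fderiv ℝ f) := hf.fderiv_right (by norm_num)
  have h₁ := ((hf'.differentiable (by norm_num)) _).hasFDerivAt.comp_hasDerivAt s
    (hasDerivAt_parabola z w y s)
  have h₂ : HasDerivAt (fun s : ℝ => w + (2 * s) • y) ((2 : ℝ) • y) s := by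
    simpa using (((hasDerivAt_id s).const_mul (2 : ℝ)).smul_const y).const_add w
  exact h₁.clm_apply h₂

theorem norm_comp_parabola_le {f : Z → F} (hf : ContDiff ℝ 2 f) {C : ℝ}
    (hC₁ : ∀ x, ‖fderiv ℝ f x‖ ≤ C) (hC₂ : ∀ x, ‖fderiv ℝ (fderiv ℝ f) x‖ ≤ C)
    {z w : Z} (y : Z) (hz : f z = 0) (hw : fderiv ℝ f z w = 0) {s : ℝ} (hs : s ∈ Set.Icc 0 1) :
    ‖f (z + s • w + s ^ 2 • y)‖ ≤ C * (‖w‖ + 2 * ‖y‖ + 1) ^ 2 * s ^ 2 := by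
  have hC : 0 ≤ C := (norm_nonneg _).trans (hC₁ z)
  set K := C * (‖w‖ + 2 * ‖y‖ + 1) ^ 2 with hK
  have hK0 : 0 ≤ K := by positivity
  have second (r : ℝ) (hr : r ∈ Set.Icc (0 : ℝ) 1) :
      ‖fderiv ℝ (fderiv ℝ f) (z + r • w + r ^ 2 • y) (w + (2 * r) • y) (w + (2 * r) • y)
        + fderiv ℝ f (z + r • w + r ^ 2 • y) ((2 : ℝ) • y)‖ ≤ K := by
    have hv : ‖w + (2 * r) • y‖ ≤ ‖w‖ + 2 * ‖y‖ := by
      refine (norm_add_le _ _).trans ?_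
      rw [norm_smul, Real.norm_of_nonneg (by linarith [hr.1])]
      nlinarith [norm_nonneg y, hr.2]
    have h₁ := ContinuousLinearMap.le_of_opNorm₂_le_of_le _ (hC₂ (z + r • w + r ^ 2 • y)) hv hv
    have h₂ := ContinuousLinearMap.le_of_opNorm_le _ (hC₁ (z + r • w + r ^ 2 • y)) ((2 : ℝ) • y)
    rw [norm_smul, Real.norm_of_nonneg (by norm_num)] at h₂
    refine (norm_add_le _ _).trans ((add_le_add h₁ h₂).trans ?_)
    have : 0 ≤ C * (2 * ‖w‖ + 2 * ‖y‖ + 1) := by positivity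
    nlinarith
  have first (r : ℝ) (hr : r ∈ Set.Icc (0 : ℝ) 1) :
      ‖fderiv ℝ f (z + r • w + r ^ 2 • y) (w + (2 * r) • y)‖ ≤ K * r := by
    have := (convex_Icc (0 : ℝ) 1).norm_image_sub_le_of_norm_hasDerivWithin_le
      (fun x _ => (hasDerivAt_fderiv_comp_parabola hf z w y x).hasDerivWithinAt) second
      (Set.left_mem_Icc.2 zero_le_one) hr
    simpa [hw, abs_of_nonneg hr.1] using this
  have := (convex_Icc (0 : ℝ) s).norm_image_sub_le_of_norm_hasDerivWithin_le
      (fun x _ => (hasDerivAt_comp_parabola hf z w y x).hasDerivWithinAt)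
      (fun x hx => (first x ⟨hx.1, hx.2.trans hs.2⟩).trans
        (mul_le_mul_of_nonneg_left hx.2 hK0))
      (Set.left_mem_Icc.2 hs.1) (Set.right_mem_Icc.2 hs.1)
  simpa [hz, abs_of_nonneg hs.1, pow_two, mul_assoc] using this

theorem tendsto_comp_parabola {f : Z → F} (hf : ContDiff ℝ 2 f) {z w : Z} (y : Z)
    (hz : f z = 0) (hw : fderiv ℝ f z w = 0) :
    Tendsto (fun h : ℝ => h⁻¹ • f (z + √h • w + h • y)) (nhdsWithin 0 (Set.Ioi 0))
      (nhds (fderiv ℝ f z y + (1 / 2 : ℝ) • fderiv ℝ (fderiv ℝ f) z w w)) := by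
  have hg : ContDiff ℝ 2 (fun s : ℝ => f (z + s • w + s ^ 2 • y)) := by fun_prop
  have d₁ : deriv (fun s : ℝ => f (z + s • w + s ^ 2 • y)) =
      fun s => fderiv ℝ f (z + s • w + s ^ 2 • y) (w + (2 * s) • y) :=
    funext fun s => (hasDerivAt_comp_parabola hf z w y s).deriv
  have d₂ := (hasDerivAt_fderiv_comp_parabola hf z w y 0).deriv
  have ht := taylor_tendsto (n := 2) convex_univ (Set.mem_univ (0 : ℝ)) hg.contDiffOn
  have heval (s : ℝ) : taylorWithinEval (fun s : ℝ => f (z + s • w + s ^ 2 • y)) 2 Set.univ 0 s =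
      s ^ 2 • (fderiv ℝ f z y + (1 / 2 : ℝ) • fderiv ℝ (fderiv ℝ f) z w w) := by
    rw [taylorWithinEval_succ, taylorWithinEval_succ, taylor_within_zero_eval]
    simp only [iteratedDerivWithin_univ, zero_add, iteratedDeriv_succ,
      iteratedDeriv_zero, d₁]
    simp only [d₂]
    simp [hz, hw, smul_smul, Nat.factorial]
    module
  have hsqrt : Tendsto Real.sqrt (nhdsWithin 0 (Set.Ioi 0)) (nhds 0) := by
    simpa using (Real.continuous_sqrt.tendsto 0).mono_left nhdsWithin_le_nhds
  rw [nhdsWithin_univ] at ht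
  have := (ht.comp hsqrt).add_const
    (fderiv ℝ f z y + (1 / 2 : ℝ) • fderiv ℝ (fderiv ℝ f) z w w)
  rw [zero_add] at this
  refine this.congr' ?_
  filter_upwards [self_mem_nhdsWithin] with h hh
  have hh : 0 < h := hh
  simp only [Function.comp_apply, heval, sub_zero, Real.sq_sqrt hh.le, smul_sub]
  rw [inv_smul_smul₀ hh.ne', sub_add_cancel]

end Taylor

theorem SchwartzMap.exists_norm_le {Z F : Type*} [NormedAddCommGroup Z] [NormedSpace ℝ Z]
    [NormedAddCommGroup F] [NormedSpace ℝ F] (f : 𝓢(Z, F)) : ∃ C, ∀ x, ‖f x‖ ≤ C := by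
  obtain ⟨C, -, hC⟩ := f.decay 0 0
  exact ⟨C, fun x => by simpa using hC x⟩

section Fourier

variable {k l : ℕ}

/-- The standard pairing on `ℝ^k × ℝ^l`. -/
def prodPairing (x ξ : (Fin k → ℝ) × (Fin l → ℝ)) : ℝ :=
  (∑ i, x.1 i * ξ.1 i) + ∑ j, x.2 j * ξ.2 j

variable (k l) in
/-- The Euclidean version of `ℝ^k × ℝ^l`, compared with the plain product. -/
noncomputable def euclideanProdEquiv :
    WithLp 2 (EuclideanSpace ℝ (Fin k) × EuclideanSpace ℝ (Fin l)) ≃L[ℝ]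
      (Fin k → ℝ) × (Fin l → ℝ) :=
  (WithLp.prodContinuousLinearEquiv 2 ℝ _ _).trans
    ((EuclideanSpace.equiv (Fin k) ℝ).prodCongr (EuclideanSpace.equiv (Fin l) ℝ))

instance isAddHaarMeasure_volume_pi_prod_pi :
    (volume : Measure ((Fin k → ℝ) × (Fin l → ℝ))).IsAddHaarMeasure :=
  Measure.prod.instIsAddHaarMeasure _ _

theorem measurePreserving_euclideanProdEquiv : MeasurePreserving (euclideanProdEquiv k l) :=
  ((PiLp.volume_preserving_ofLp (Fin k)).prod (PiLp.volume_preserving_ofLp (Fin l))).comp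
    (WithLp.volume_preserving_ofLp _ _)

theorem inner_eq_prodPairing
    (x ξ : WithLp 2 (EuclideanSpace ℝ (Fin k) × EuclideanSpace ℝ (Fin l))) :
    inner ℝ x ξ = prodPairing (euclideanProdEquiv k l x) (euclideanProdEquiv k l ξ) := by
  simp [prodPairing, euclideanProdEquiv, WithLp.prod_inner_apply, PiLp.inner_apply, mul_comm]

theorem integral_comp_euclideanProdEquiv (g : (Fin k → ℝ) × (Fin l → ℝ) → ℂ) :
    ∫ x, g (euclideanProdEquiv k l x) = ∫ x, g x :=
  measurePreserving_euclideanProdEquiv.integral_comp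
    (euclideanProdEquiv k l).toHomeomorph.measurableEmbedding g

variable (k l) in
/-- The linear isomorphism `ξ ↦ ξ / (2π)` from the plain to the Euclidean product. -/
noncomputable def angularEquiv :
    ((Fin k → ℝ) × (Fin l → ℝ)) ≃L[ℝ]
      WithLp 2 (EuclideanSpace ℝ (Fin k) × EuclideanSpace ℝ (Fin l)) :=
  (ContinuousLinearEquiv.smulLeft (Units.mk0 (2 * Real.pi)⁻¹ (by positivity))).trans
    (euclideanProdEquiv k l).symm

theorem euclideanProdEquiv_angularEquiv (ξ : (Fin k → ℝ) × (Fin l → ℝ)) :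
    euclideanProdEquiv k l (angularEquiv k l ξ) = (2 * Real.pi)⁻¹ • ξ :=
  (euclideanProdEquiv k l).apply_symm_apply _

variable (k l) in
/-- The Fourier transform `f ↦ ∫ e^{-i x·ξ} f(x) dx` on Schwartz functions on `ℝ^k × ℝ^l`. -/
noncomputable def angularFourier :
    𝓢((Fin k → ℝ) × (Fin l → ℝ), ℂ) →L[ℂ] 𝓢((Fin k → ℝ) × (Fin l → ℝ), ℂ) :=
  SchwartzMap.compCLMOfContinuousLinearEquiv ℂ (angularEquiv k l) ∘L
    SchwartzMap.fourierTransformCLM ℂ ∘L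
      SchwartzMap.compCLMOfContinuousLinearEquiv ℂ (euclideanProdEquiv k l)

theorem angularFourier_eq (f : 𝓢((Fin k → ℝ) × (Fin l → ℝ), ℂ)) (ξ : (Fin k → ℝ) × (Fin l → ℝ)) :
    angularFourier k l f ξ =
      𝓕 (SchwartzMap.compCLMOfContinuousLinearEquiv ℂ (euclideanProdEquiv k l) f)
        (angularEquiv k l ξ) := rfl

theorem prodPairing_smul_right (c : ℝ) (x ξ : (Fin k → ℝ) × (Fin l → ℝ)) :
    prodPairing x (c • ξ) = c * prodPairing x ξ := by
  simp [prodPairing, mul_add, Finset.mul_sum, mul_left_comm]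

theorem prodPairing_comm (x ξ : (Fin k → ℝ) × (Fin l → ℝ)) :
    prodPairing x ξ = prodPairing ξ x := by
  simp [prodPairing, mul_comm]

theorem angularFourier_apply (f : 𝓢((Fin k → ℝ) × (Fin l → ℝ), ℂ))
    (ξ : (Fin k → ℝ) × (Fin l → ℝ)) :
    angularFourier k l f ξ = ∫ x, Complex.exp (-Complex.I * (prodPairing x ξ : ℂ)) * f x := by
  rw [angularFourier_eq, SchwartzMap.fourier_coe, Real.fourier_eq',
    ← integral_comp_euclideanProdEquiv]
  congr! 2 with x
  rw [inner_eq_prodPairing, euclideanProdEquiv_angularEquiv, prodPairing_smul_right, smul_eq_mul,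
    SchwartzMap.compCLMOfContinuousLinearEquiv_apply, Function.comp_apply]
  congr 2
  push_cast
  field_simp

theorem angularFourier_inversion (f : 𝓢((Fin k → ℝ) × (Fin l → ℝ), ℂ))
    (x : (Fin k → ℝ) × (Fin l → ℝ)) :
    (((2 * Real.pi) ^ (k + l) : ℝ) : ℂ)⁻¹ *
      ∫ ξ, Complex.exp (Complex.I * (prodPairing x ξ : ℂ)) * angularFourier k l f ξ = f x := by
  have hpi : (2 * Real.pi) ≠ 0 := by positivity
  have hscale := Measure.integral_comp_smul
    (volume : Measure ((Fin k → ℝ) × (Fin l → ℝ)))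
    (fun ξ => Complex.exp (Complex.I * (prodPairing x ξ : ℂ)) * angularFourier k l f ξ)
    (2 * Real.pi)
  rw [Module.finrank_prod, Module.finrank_fin_fun, Module.finrank_fin_fun,
    abs_of_pos (by positivity), Complex.real_smul, Complex.ofReal_inv] at hscale
  rw [← hscale, ← integral_comp_euclideanProdEquiv]
  set g := SchwartzMap.compCLMOfContinuousLinearEquiv ℂ (euclideanProdEquiv k l) f with hg
  have hinv : 𝓕⁻ (𝓕 g) ((euclideanProdEquiv k l).symm x) = f x := by
    rw [FourierTransform.fourierInv_fourier_eq, hg]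
    simp
  rw [← hinv, SchwartzMap.fourierInv_coe, Real.fourierInv_eq']
  congr! 2 with η
  have hη : angularEquiv k l ((2 * Real.pi) • euclideanProdEquiv k l η) = η := by
    apply (euclideanProdEquiv k l).injective
    rw [euclideanProdEquiv_angularEquiv, inv_smul_smul₀ hpi]
  rw [inner_eq_prodPairing, angularFourier_eq, hη, prodPairing_smul_right,
    ContinuousLinearEquiv.apply_symm_apply, prodPairing_comm, smul_eq_mul]
  congr 2
  push_cast
  ring

theorem angularFourier_lineDeriv (f : 𝓢((Fin k → ℝ) × (Fin l → ℝ), ℂ))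
    (m ξ : (Fin k → ℝ) × (Fin l → ℝ)) :
    angularFourier k l (∂_{m} f) ξ =
      Complex.I * (prodPairing m ξ : ℂ) * angularFourier k l f ξ := by
  have hm : SchwartzMap.compCLMOfContinuousLinearEquiv ℂ (euclideanProdEquiv k l) (∂_{m} f) =
      ∂_{(euclideanProdEquiv k l).symm m}
        (SchwartzMap.compCLMOfContinuousLinearEquiv ℂ (euclideanProdEquiv k l) f) := by
    rw [SchwartzMap.lineDerivOp_compCLMOfContinuousLinearEquiv,
      ContinuousLinearEquiv.apply_symm_apply]
  have ht : (fun x => inner ℝ x ((euclideanProdEquiv k l).symm m)).HasTemperateGrowth := by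
    fun_prop
  rw [angularFourier_eq, hm, SchwartzMap.fourier_lineDerivOp_eq, smul_apply,
    SchwartzMap.smulLeftCLM_apply_apply ht, ← angularFourier_eq, inner_eq_prodPairing,
    euclideanProdEquiv_angularEquiv, ContinuousLinearEquiv.apply_symm_apply, prodPairing_comm,
    prodPairing_smul_right, smul_eq_mul, Complex.real_smul]
  push_cast
  field_simp

end Fourier

section Transport

variable {k l : ℕ}

theorem prodPairing_single_left (j : Fin k) (ξ : (Fin k → ℝ) × (Fin l → ℝ)) :
    prodPairing (Pi.single j 1, 0) ξ = ξ.1 j := by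
  simp [prodPairing, Pi.single_apply]

theorem prodPairing_single_right (j : Fin l) (ξ : (Fin k → ℝ) × (Fin l → ℝ)) :
    prodPairing (0, Pi.single j 1) ξ = ξ.2 j := by
  simp [prodPairing, Pi.single_apply]

theorem tau_eq_sum_dirTau (τ : Fin k → ℝ) :
    (((0, 0), (τ, 0)) : ((Fin k → ℝ) × (Fin l → ℝ)) × ((Fin k → ℝ) × (Fin l → ℝ))) =
      ∑ j, τ j • dirTau k l j := by
  ext i <;> simp [dirTau, Prod.fst_sum, Prod.snd_sum, Finset.sum_apply, Pi.single_apply]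

theorem transverse_eq_sum (v μ : Fin l → ℝ) :
    (((0, v), (0, μ)) : ((Fin k → ℝ) × (Fin l → ℝ)) × ((Fin k → ℝ) × (Fin l → ℝ))) =
      ∑ j, v j • dirU k l j + ∑ j, μ j • dirMu k l j := by
  ext i <;> simp [dirU, dirMu, Prod.fst_sum, Prod.snd_sum, Finset.sum_apply, Pi.single_apply]

theorem symbol_argument (t : Fin k → ℝ) (v : Fin l → ℝ) (ξ : (Fin k → ℝ) × (Fin l → ℝ))
    (r h : ℝ) :
    (((t, 0), (0, 0)) : ((Fin k → ℝ) × (Fin l → ℝ)) × ((Fin k → ℝ) × (Fin l → ℝ)))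
      + r • ((0, v), (0, ξ.2)) + h • ((0, 0), (ξ.1, 0)) = ((t, r • v), (h • ξ.1, r • ξ.2)) := by
  simp

/-- The right-hand side of the second transport equation at `(t, v)`, as a Schwartz function
obtained by applying to `a` the differential operator with coefficients frozen at `(t, v)`. -/
noncomputable def transportSchwartz
    (p₀ p₁ : 𝓢(((Fin k → ℝ) × (Fin l → ℝ)) × ((Fin k → ℝ) × (Fin l → ℝ)), ℂ))
    (a : 𝓢((Fin k → ℝ) × (Fin l → ℝ), ℂ)) (t : Fin k → ℝ) (v : Fin l → ℝ) :
    𝓢((Fin k → ℝ) × (Fin l → ℝ), ℂ) :=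
  p₁ ((t, 0), (0, 0)) • a
    + Complex.I⁻¹ • ∑ j : Fin k, fderiv ℝ (fun z => p₀ z) ((t, 0), (0, 0)) (dirTau k l j) •
        ∂_{((Pi.single j 1, 0) : (Fin k → ℝ) × (Fin l → ℝ))} a
    + (1 / 2 : ℂ) • ∑ i : Fin l, ∑ j : Fin l,
      ((fderiv ℝ (fderiv ℝ (fun z => p₀ z)) ((t, 0), (0, 0)) (dirU k l i) (dirU k l j) *
            (v i : ℂ) * (v j : ℂ)) • a
        + ((2 / Complex.I) * fderiv ℝ (fderiv ℝ (fun z => p₀ z)) ((t, 0), (0, 0)) (dirU k l i)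
            (dirMu k l j) * (v i : ℂ)) • ∂_{((0, Pi.single j 1) : (Fin k → ℝ) × (Fin l → ℝ))} a
        - fderiv ℝ (fderiv ℝ (fun z => p₀ z)) ((t, 0), (0, 0)) (dirMu k l i) (dirMu k l j) •
            ∂_{((0, Pi.single i 1) : (Fin k → ℝ) × (Fin l → ℝ))}
              (∂_{((0, Pi.single j 1) : (Fin k → ℝ) × (Fin l → ℝ))} a))

theorem transportSchwartz_apply
    (p₀ p₁ : 𝓢(((Fin k → ℝ) × (Fin l → ℝ)) × ((Fin k → ℝ) × (Fin l → ℝ)), ℂ))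
    (a : 𝓢((Fin k → ℝ) × (Fin l → ℝ), ℂ)) (t : Fin k → ℝ) (v : Fin l → ℝ)
    (x : (Fin k → ℝ) × (Fin l → ℝ)) :
    transportSchwartz p₀ p₁ a t v x =
      p₁ ((t, 0), (0, 0)) * a x
        + Complex.I⁻¹ *
            ∑ j : Fin k,
              fderiv ℝ (fun z => p₀ z) ((t, 0), (0, 0)) (dirTau k l j) *
                fderiv ℝ (fun z => a z) x (Pi.single j 1, 0)
        + (1 / 2 : ℂ) *
            ∑ i : Fin l, ∑ j : Fin l,
              (fderiv ℝ (fderiv ℝ (fun z => p₀ z)) ((t, 0), (0, 0)) (dirU k l i)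
                  (dirU k l j) * (v i : ℂ) * (v j : ℂ) * a x
              + (2 / Complex.I) *
                  fderiv ℝ (fderiv ℝ (fun z => p₀ z)) ((t, 0), (0, 0)) (dirU k l i)
                    (dirMu k l j) * (v i : ℂ) *
                    fderiv ℝ (fun z => a z) x (0, Pi.single j 1)
              - fderiv ℝ (fderiv ℝ (fun z => p₀ z)) ((t, 0), (0, 0)) (dirMu k l i)
                    (dirMu k l j) *
                  fderiv ℝ (fderiv ℝ (fun z => a z)) x (0, Pi.single i 1)
                    (0, Pi.single j 1)) := by
  have hsecond (m n : (Fin k → ℝ) × (Fin l → ℝ)) :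
      ∂_{m} (∂_{n} a) x = fderiv ℝ (fderiv ℝ (fun z => a z)) x m n := by
    have hd : DifferentiableAt ℝ (fderiv ℝ (fun z => a z)) x :=
      (((a.smooth 2).fderiv_right (m := 1) (by norm_num)).differentiable (by norm_num)) x
    have hfun : (fun z => (∂_{n} a) z) = fun z => fderiv ℝ (fun z => a z) z n :=
      funext fun z => SchwartzMap.lineDerivOp_apply_eq_fderiv n a z
    rw [SchwartzMap.lineDerivOp_apply_eq_fderiv]
    change fderiv ℝ (fun z => (∂_{n} a) z) x m = _
    rw [hfun, fderiv_clm_apply hd (differentiableAt_const n)]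
    simp
  simp only [transportSchwartz, add_apply, sub_apply, smul_apply,
    sum_apply, hsecond, SchwartzMap.lineDerivOp_apply_eq_fderiv, smul_eq_mul]

theorem fderiv_fderiv_transverse
    (p : 𝓢(((Fin k → ℝ) × (Fin l → ℝ)) × ((Fin k → ℝ) × (Fin l → ℝ)), ℂ)) (t : Fin k → ℝ)
    (v μ : Fin l → ℝ) :
    fderiv ℝ (fderiv ℝ p) ((t, 0), (0, 0)) ((0, v), (0, μ)) ((0, v), (0, μ)) =
      ∑ i, ∑ j, (fderiv ℝ (fderiv ℝ p) ((t, 0), (0, 0)) (dirU k l i) (dirU k l j) * v i * v j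
        + 2 * fderiv ℝ (fderiv ℝ p) ((t, 0), (0, 0)) (dirU k l i) (dirMu k l j) * v i * μ j
        + fderiv ℝ (fderiv ℝ p) ((t, 0), (0, 0)) (dirMu k l i) (dirMu k l j) * μ i * μ j) := by
  have hsymm := (p.smooth 2).contDiffAt.isSymmSndFDerivAt (x := ((t, 0), (0, 0))) (by simp)
  have hcross : ∑ i, ∑ j, (μ i : ℂ) * ((v j : ℂ) *
        fderiv ℝ (fderiv ℝ p) ((t, 0), (0, 0)) (dirU k l j) (dirMu k l i)) =
      ∑ i, ∑ j, (v i : ℂ) * ((μ j : ℂ) *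
        fderiv ℝ (fderiv ℝ p) ((t, 0), (0, 0)) (dirU k l i) (dirMu k l j)) := by
    rw [Finset.sum_comm]
    simp only [mul_left_comm]
  rw [transverse_eq_sum]
  simp only [map_add, map_smul, map_sum, add_apply, smul_apply, sum_apply,
    Complex.real_smul, mul_add, Finset.mul_sum, Finset.sum_add_distrib]
  rw [hcross]
  simp only [← Finset.sum_add_distrib]
  refine Finset.sum_congr rfl fun i _ => Finset.sum_congr rfl fun j _ => ?_
  rw [hsymm.eq (dirU k l i) (dirU k l j), hsymm.eq (dirMu k l i) (dirMu k l j),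
    hsymm.eq (dirU k l i) (dirMu k l j)]
  ring

theorem angularFourier_transportSchwartz
    (p₀ p₁ : 𝓢(((Fin k → ℝ) × (Fin l → ℝ)) × ((Fin k → ℝ) × (Fin l → ℝ)), ℂ))
    (a : 𝓢((Fin k → ℝ) × (Fin l → ℝ), ℂ)) (t : Fin k → ℝ) (v : Fin l → ℝ)
    (ξ : (Fin k → ℝ) × (Fin l → ℝ)) :
    angularFourier k l (transportSchwartz p₀ p₁ a t v) ξ =
      (fderiv ℝ p₀ ((t, 0), (0, 0)) ((0, 0), (ξ.1, 0)) + (1 / 2 : ℝ) •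
          fderiv ℝ (fderiv ℝ p₀) ((t, 0), (0, 0)) ((0, v), (0, ξ.2)) ((0, v), (0, ξ.2))
        + p₁ ((t, 0), (0, 0))) * angularFourier k l a ξ := by
  have hτ : Complex.I⁻¹ * ∑ j : Fin k, fderiv ℝ p₀ ((t, 0), (0, 0)) (dirTau k l j) *
      (Complex.I * (ξ.1 j : ℂ) * angularFourier k l a ξ) =
        fderiv ℝ p₀ ((t, 0), (0, 0)) ((0, 0), (ξ.1, 0)) * angularFourier k l a ξ := by
    rw [tau_eq_sum_dirTau, map_sum, Finset.mul_sum, Finset.sum_mul]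
    refine Finset.sum_congr rfl fun j _ => ?_
    rw [map_smul, Complex.real_smul]
    field_simp
  rw [fderiv_fderiv_transverse, Complex.real_smul, add_mul, add_mul, ← hτ]
  simp only [transportSchwartz, map_add, map_sub, map_smul, map_sum, add_apply,
    sub_apply, smul_apply, sum_apply, angularFourier_lineDeriv,
    prodPairing_single_left, prodPairing_single_right, smul_eq_mul]
  rw [add_comm (p₁ _ * _), add_right_comm]
  congr 2
  rw [mul_assoc, Finset.sum_mul]
  push_cast
  congr 1
  refine Finset.sum_congr rfl fun i _ => ?_
  rw [Finset.sum_mul]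
  refine Finset.sum_congr rfl fun j _ => ?_
  field_simp
  linear_combination (-(fderiv ℝ (fderiv ℝ p₀) ((t, 0), (0, 0)) (dirMu k l i) (dirMu k l j)) *
    ξ.2 i * ξ.2 j * angularFourier k l a ξ) * Complex.I_sq

theorem exists_norm_symbol_le
    (p : 𝓢(((Fin k → ℝ) × (Fin l → ℝ)) × ((Fin k → ℝ) × (Fin l → ℝ)), ℂ)) (t : Fin k → ℝ)
    (v : Fin l → ℝ) (hp : p ((t, 0), (0, 0)) = 0)
    (hd : ∀ μ, fderiv ℝ p ((t, 0), (0, 0)) ((0, v), (0, μ)) = 0) :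
    ∃ K, ∀ h ∈ Set.Ioc (0 : ℝ) 1, ∀ ξ : (Fin k → ℝ) × (Fin l → ℝ),
      ‖(h : ℂ)⁻¹ * p ((t, √h • v), (h • ξ.1, √h • ξ.2))‖ ≤ K * (1 + ‖ξ‖ ^ 2) := by
  obtain ⟨C₁, hC₁⟩ := (SchwartzMap.fderivCLM ℝ _ _ p).exists_norm_le
  obtain ⟨C₂, hC₂⟩ :=
    (SchwartzMap.fderivCLM ℝ _ _ (SchwartzMap.fderivCLM ℝ _ _ p)).exists_norm_le
  set C := max C₁ C₂
  have hC : 0 ≤ C := (norm_nonneg _).trans ((hC₁ 0).trans (le_max_left _ _))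
  refine ⟨C * (2 * (‖v‖ + 1) ^ 2 + 18), fun h hh ξ => ?_⟩
  have hmain := norm_comp_parabola_le (p.smooth 2) (C := C)
    (fun x => (hC₁ x).trans (le_max_left _ _)) (fun x => (hC₂ x).trans (le_max_right _ _))
    ((0, 0), (ξ.1, 0)) hp (hd ξ.2) (s := √h) ⟨Real.sqrt_nonneg h, Real.sqrt_le_one.2 hh.2⟩
  rw [Real.sq_sqrt hh.1.le, symbol_argument] at hmain
  have hw : ‖(((0, v), (0, ξ.2)) : ((Fin k → ℝ) × (Fin l → ℝ)) × ((Fin k → ℝ) × (Fin l → ℝ)))‖ ≤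
      ‖v‖ + ‖ξ‖ := by
    have := norm_snd_le ξ
    simp only [Prod.norm_mk, norm_zero]
    refine max_le (max_le ?_ ?_) (max_le ?_ ?_) <;>
      linarith [norm_nonneg v, norm_nonneg ξ]
  have hy : ‖(((0, 0), (ξ.1, 0)) : ((Fin k → ℝ) × (Fin l → ℝ)) × ((Fin k → ℝ) × (Fin l → ℝ)))‖ ≤
      ‖ξ‖ := by
    have := norm_fst_le ξ
    simp only [Prod.norm_mk, norm_zero]
    refine max_le (max_le ?_ ?_) (max_le ?_ ?_) <;> linarith [norm_nonneg ξ]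
  rw [norm_mul, norm_inv, Complex.norm_real, Real.norm_of_nonneg hh.1.le,
    inv_mul_le_iff₀ hh.1]
  refine hmain.trans ?_
  rw [mul_comm h]
  refine mul_le_mul_of_nonneg_right ?_ hh.1.le
  rw [mul_assoc]
  refine mul_le_mul_of_nonneg_left ?_ hC
  calc _ ≤ (‖v‖ + ‖ξ‖ + 2 * ‖ξ‖ + 1) ^ 2 := by gcongr
    _ ≤ _ := by nlinarith [sq_nonneg (‖v‖ + 1 - 3 * ‖ξ‖), sq_nonneg ((‖v‖ + 1) * ‖ξ‖)]

theorem tendsto_symbol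
    (p₀ p₁ : 𝓢(((Fin k → ℝ) × (Fin l → ℝ)) × ((Fin k → ℝ) × (Fin l → ℝ)), ℂ)) (t : Fin k → ℝ)
    (v : Fin l → ℝ) (hp : p₀ ((t, 0), (0, 0)) = 0)
    (hd : ∀ μ, fderiv ℝ p₀ ((t, 0), (0, 0)) ((0, v), (0, μ)) = 0)
    (ξ : (Fin k → ℝ) × (Fin l → ℝ)) :
    Tendsto (fun h : ℝ => (h : ℂ)⁻¹ * p₀ ((t, √h • v), (h • ξ.1, √h • ξ.2)) +
        p₁ ((t, √h • v), (h • ξ.1, √h • ξ.2))) (nhdsWithin 0 (Set.Ioi 0))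
      (nhds (fderiv ℝ p₀ ((t, 0), (0, 0)) ((0, 0), (ξ.1, 0)) + (1 / 2 : ℝ) •
          fderiv ℝ (fderiv ℝ p₀) ((t, 0), (0, 0)) ((0, v), (0, ξ.2)) ((0, v), (0, ξ.2))
        + p₁ ((t, 0), (0, 0)))) := by
  refine Tendsto.add ?_ ?_
  · have := tendsto_comp_parabola (p₀.smooth 2) ((0, 0), (ξ.1, 0)) hp (hd ξ.2)
    simpa only [symbol_argument, Complex.real_smul, Complex.ofReal_inv] using this
  · have hc : Continuous fun h : ℝ => p₁ ((t, √h • v), (h • ξ.1, √h • ξ.2)) :=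
      p₁.continuous.comp (by fun_prop)
    simpa using (hc.tendsto 0).mono_left nhdsWithin_le_nhds

theorem tendsto_integral_symbol
    (p₀ p₁ : 𝓢(((Fin k → ℝ) × (Fin l → ℝ)) × ((Fin k → ℝ) × (Fin l → ℝ)), ℂ)) (t : Fin k → ℝ)
    (v : Fin l → ℝ) (hp : p₀ ((t, 0), (0, 0)) = 0)
    (hd : ∀ μ, fderiv ℝ p₀ ((t, 0), (0, 0)) ((0, v), (0, μ)) = 0)
    (b : 𝓢((Fin k → ℝ) × (Fin l → ℝ), ℂ)) :
    Tendsto (fun h : ℝ => ∫ ξ : (Fin k → ℝ) × (Fin l → ℝ),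
        Complex.exp (Complex.I * (prodPairing (t, v) ξ : ℂ)) *
          (((h : ℂ)⁻¹ * p₀ ((t, √h • v), (h • ξ.1, √h • ξ.2)) +
            p₁ ((t, √h • v), (h • ξ.1, √h • ξ.2))) * b ξ))
      (nhdsWithin 0 (Set.Ioi 0))
      (nhds (∫ ξ, Complex.exp (Complex.I * (prodPairing (t, v) ξ : ℂ)) *
        ((fderiv ℝ p₀ ((t, 0), (0, 0)) ((0, 0), (ξ.1, 0)) + (1 / 2 : ℝ) •
          fderiv ℝ (fderiv ℝ p₀) ((t, 0), (0, 0)) ((0, v), (0, ξ.2)) ((0, v), (0, ξ.2))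
        + p₁ ((t, 0), (0, 0))) * b ξ))) := by
  obtain ⟨K, hK⟩ := exists_norm_symbol_le p₀ t v hp hd
  obtain ⟨C, hC⟩ := p₁.exists_norm_le
  refine tendsto_integral_filter_of_dominated_convergence
    (fun ξ => (K + C) * ‖b ξ‖ + K * (‖ξ‖ ^ 2 * ‖b ξ‖)) ?_ ?_ ?_ ?_
  · refine Eventually.of_forall fun h => Continuous.aestronglyMeasurable ?_
    have hp₀ : Continuous fun ξ : (Fin k → ℝ) × (Fin l → ℝ) =>
        p₀ ((t, √h • v), (h • ξ.1, √h • ξ.2)) := p₀.continuous.comp (by fun_prop)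
    have hp₁ : Continuous fun ξ : (Fin k → ℝ) × (Fin l → ℝ) =>
        p₁ ((t, √h • v), (h • ξ.1, √h • ξ.2)) := p₁.continuous.comp (by fun_prop)
    have hb := b.continuous
    unfold prodPairing
    fun_prop
  · filter_upwards [Ioc_mem_nhdsGT (zero_lt_one' ℝ)] with h hh
    refine Eventually.of_forall fun ξ => ?_
    rw [norm_mul, norm_mul, mul_comm Complex.I, Complex.norm_exp_ofReal_mul_I, one_mul]
    calc _ ≤ (K * (1 + ‖ξ‖ ^ 2) + C) * ‖b ξ‖ :=
          mul_le_mul_of_nonneg_right ((norm_add_le _ _).trans (add_le_add (hK h hh ξ) (hC _)))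
            (norm_nonneg _)
      _ = _ := by ring
  · exact ((b.integrable.norm).const_mul _).add ((b.integrable_pow_mul volume 2).const_mul _)
  · exact Eventually.of_forall fun ξ =>
      ((tendsto_symbol p₀ p₁ t v hp hd ξ).mul_const _).const_mul _

end Transport

/-- Second transport equation: if `p₀` vanishes on the model isotropic
`Σ₀ = {(t,0;0,0)}` together with its `u` and `μ` derivatives (i.e. its Hamilton field is
tangent to `Σ₀`), then for the total symbol `p₀ + hbar p₁`,
`lim_{hbar→0⁺} hbar^{-1} b_hbar(t,v)` equals the displayed second-order expression. -/
theorem second_transport_equation (k l : ℕ)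
    (p₀ p₁ : SchwartzMap (((Fin k → ℝ) × (Fin l → ℝ)) × ((Fin k → ℝ) × (Fin l → ℝ))) ℂ)
    (hp0 : ∀ t : Fin k → ℝ, p₀ ((t, 0), (0, 0)) = 0)
    (hpu : ∀ (t : Fin k → ℝ) (j : Fin l),
      fderiv ℝ (fun z => p₀ z) ((t, 0), (0, 0)) (dirU k l j) = 0)
    (hpmu : ∀ (t : Fin k → ℝ) (j : Fin l),
      fderiv ℝ (fun z => p₀ z) ((t, 0), (0, 0)) (dirMu k l j) = 0)
    (a : SchwartzMap ((Fin k → ℝ) × (Fin l → ℝ)) ℂ)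
    (ahat : (Fin k → ℝ) × (Fin l → ℝ) → ℂ)
    (hahat : ∀ σν : (Fin k → ℝ) × (Fin l → ℝ),
      ahat σν = ∫ q : (Fin k → ℝ) × (Fin l → ℝ),
        Complex.exp (-Complex.I *
          (((∑ i, q.1 i * σν.1 i) + ∑ j, q.2 j * σν.2 j : ℝ) : ℂ)) * a q)
    (t : Fin k → ℝ) (v : Fin l → ℝ) :
    Tendsto (fun hbar : ℝ =>
        ((hbar : ℂ))⁻¹ *
          (((((2 * Real.pi) ^ (k + l) : ℝ)) : ℂ)⁻¹ *
            ∫ ξ : (Fin k → ℝ) × (Fin l → ℝ),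
              Complex.exp (Complex.I *
                (((∑ i, t i * ξ.1 i) + ∑ j, v j * ξ.2 j : ℝ) : ℂ)) *
                (p₀ ((t, Real.sqrt hbar • v), (hbar • ξ.1, Real.sqrt hbar • ξ.2)) +
                  (hbar : ℂ) *
                    p₁ ((t, Real.sqrt hbar • v), (hbar • ξ.1, Real.sqrt hbar • ξ.2))) *
                ahat ξ))
      (nhdsWithin 0 (Set.Ioi 0))
      (nhds
        (p₁ ((t, 0), (0, 0)) * a (t, v)
        + Complex.I⁻¹ *
            ∑ j : Fin k,
              fderiv ℝ (fun z => p₀ z) ((t, 0), (0, 0)) (dirTau k l j) *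
                fderiv ℝ (fun z => a z) (t, v) (Pi.single j 1, 0)
        + (1 / 2 : ℂ) *
            ∑ i : Fin l, ∑ j : Fin l,
              (fderiv ℝ (fderiv ℝ (fun z => p₀ z)) ((t, 0), (0, 0)) (dirU k l i)
                  (dirU k l j) * (v i : ℂ) * (v j : ℂ) * a (t, v)
              + (2 / Complex.I) *
                  fderiv ℝ (fderiv ℝ (fun z => p₀ z)) ((t, 0), (0, 0)) (dirU k l i)
                    (dirMu k l j) * (v i : ℂ) *
                    fderiv ℝ (fun z => a z) (t, v) (0, Pi.single j 1)
              - fderiv ℝ (fderiv ℝ (fun z => p₀ z)) ((t, 0), (0, 0)) (dirMu k l i)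
                    (dirMu k l j) *
                  fderiv ℝ (fderiv ℝ (fun z => a z)) (t, v) (0, Pi.single i 1)
                    (0, Pi.single j 1)))) := by
  have hd (μ : Fin l → ℝ) : fderiv ℝ p₀ ((t, 0), (0, 0)) ((0, v), (0, μ)) = 0 := by
    rw [transverse_eq_sum, map_add, map_sum, map_sum,
      Finset.sum_eq_zero fun j _ => ?_, Finset.sum_eq_zero fun j _ => ?_, add_zero]
    · rw [map_smul, hpmu t j, smul_zero]
    · rw [map_smul, hpu t j, smul_zero]
  have hhat : ahat = angularFourier k l a :=
    funext fun ξ => (hahat ξ).trans (angularFourier_apply a ξ).symm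
  rw [← transportSchwartz_apply, ← angularFourier_inversion]
  simp only [angularFourier_transportSchwartz]
  refine ((tendsto_integral_symbol p₀ p₁ t v (hp0 t) hd (angularFourier k l a)).const_mul
    _).congr' ?_
  filter_upwards [self_mem_nhdsWithin] with h hh
  have hne : (h : ℂ) ≠ 0 := Complex.ofReal_ne_zero.2 (ne_of_gt hh)
  rw [mul_left_comm, ← integral_const_mul (h : ℂ)⁻¹, hhat]
  congr 1
  refine integral_congr_ae (.of_forall fun ξ => ?_)
  dsimp only [prodPairing]
  field_simp
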